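/- arXiv:1804.07936 — 2 statements merged into one kernel-verified Lean document; each statement's English description precedes it below -/
import Mathlib

section
/- Let s ∈ ℂ with 0 < Re(s) < 1. Then the iterated limit lim_{ε→0⁺} lim_{R→∞} (1/Γ(s)) ∫_0^R r^{s−1} · ( e^{−2πi(1/2 + iε − r)} − 1 )^{−1} dr exists, and the Riemann zeta function satisfies ζ(s) = ( (2πi)^s / (2^{1−s} − 1) ) · lim_{ε→0⁺} lim_{R→∞} (1/Γ(s)) ∫_0^R r^{s−1} · ( e^{−2πi(1/2 + iε − r)} − 1 )^{−1} dr. -/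
open Complex Real MeasureTheory Filter intervalIntegral

lemma aux_norm (s z : ℂ) {t : ℝ} (ht : 0 < t) :
    ‖(t : ℂ) ^ (s - 1) * Complex.exp (-(z * t))‖ = t ^ (s.re - 1) * rexp (-z.re * t) := by
  rw [norm_mul, norm_cpow_eq_rpow_re_of_pos ht, Complex.norm_exp]
  simp

lemma aux_meas (s z : ℂ) (S : Set ℝ) (hS : S ⊆ Set.Ioi 0) (hm : MeasurableSet S) :
    AEStronglyMeasurable (fun t : ℝ => (t : ℂ) ^ (s - 1) * Complex.exp (-(z * t)))
      (volume.restrict S) := by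
  apply ContinuousOn.aestronglyMeasurable _ hm
  intro t ht
  have : (0:ℝ) < t := hS ht
  apply ContinuousAt.continuousWithinAt
  apply ContinuousAt.mul
  · exact continuousAt_ofReal_cpow_const _ _ (Or.inr this.ne')
  · fun_prop

lemma aux_real_int {c b : ℝ} (hc : 0 < c) (hb : 0 < b) :
    IntegrableOn (fun t : ℝ => t ^ (c - 1) * rexp (-b * t)) (Set.Ioi 0) := by
  have := integrableOn_rpow_mul_exp_neg_mul_rpow (p := 1) (s := c - 1) (b := b)
    (by linarith) one_pos hb
  simpa using this

lemma aux_int {s z : ℂ} (hs : 0 < s.re) (hz : 0 < z.re) :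
    IntegrableOn (fun t : ℝ => (t : ℂ) ^ (s - 1) * Complex.exp (-(z * t))) (Set.Ioi 0) := by
  refine Integrable.mono' (aux_real_int hs hz) (aux_meas s z _ subset_rfl measurableSet_Ioi) ?_
  filter_upwards [ae_restrict_mem measurableSet_Ioi] with t ht
  exact (aux_norm s z ht).le

lemma aux_diff {s z : ℂ} (hs : 0 < s.re) (hz : 0 < z.re) :
    DifferentiableAt ℂ (fun z : ℂ => ∫ t in Set.Ioi (0:ℝ),
      (t : ℂ) ^ (s - 1) * Complex.exp (-(z * t))) z := by
  have h := hasDerivAt_integral_of_dominated_loc_of_deriv_le (𝕜 := ℂ)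
    (μ := volume.restrict (Set.Ioi (0:ℝ)))
    (F := fun z t => (t : ℂ) ^ (s - 1) * Complex.exp (-(z * t)))
    (F' := fun z t => (t : ℂ) ^ (s - 1) * (Complex.exp (-(z * t)) * (-(1 * (t:ℂ))))) (x₀ := z)
    (s := {w : ℂ | z.re / 2 < w.re})
    (bound := fun t : ℝ => t ^ (s.re + 1 - 1) * rexp (-(z.re/2) * t))
    ((isOpen_lt continuous_const continuous_re).mem_nhds (by simp; linarith))
    (Eventually.of_forall fun w => aux_meas s w _ subset_rfl measurableSet_Ioi)
    (aux_int hs hz) ?_ ?_ (aux_real_int (by linarith) (by linarith)) ?_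
  · exact h.2.differentiableAt
  · have := (aux_meas s z _ subset_rfl measurableSet_Ioi).mul
      (f := fun t : ℝ => (t : ℂ) ^ (s - 1) * Complex.exp (-(z * t)))
      (g := fun t : ℝ => -(1 * (t:ℂ)))
      (μ := volume.restrict (Set.Ioi (0:ℝ))) (by fun_prop)
    refine this.congr (Eventually.of_forall fun t => ?_)
    simp [mul_assoc]
  · filter_upwards [ae_restrict_mem measurableSet_Ioi] with t ht w hw
    have ht : 0 < t := ht
    rw [← mul_assoc, norm_mul, aux_norm s w ht]
    have hw : z.re / 2 < w.re := hw
    have h1 : ‖-(1 * (t:ℂ))‖ = t := by simp [abs_of_pos ht]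
    have h2 : t ^ (s.re + 1 - 1) = t ^ (s.re - 1) * t := by
      rw [← rpow_add_one ht.ne']; ring_nf
    rw [h1, h2]
    have : rexp (-w.re * t) ≤ rexp (-(z.re/2) * t) := by
      apply Real.exp_le_exp.mpr; nlinarith
    calc _ = t ^ (s.re - 1) * t * rexp (-w.re * t) := by ring
      _ ≤ _ := by gcongr
  · refine Eventually.of_forall fun t w _ => ?_
    exact (((hasDerivAt_id w).mul_const (t:ℂ)).neg.cexp).const_mul _

lemma aux_gamma {s z : ℂ} (hs : 0 < s.re) (hz : 0 < z.re) :
    ∫ t in Set.Ioi (0:ℝ), (t : ℂ) ^ (s - 1) * Complex.exp (-(z * t)) =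
      z ^ (-s) * Complex.Gamma s := by
  have hopen : IsOpen {w : ℂ | 0 < w.re} := isOpen_lt continuous_const continuous_re
  have hconv : IsPreconnected {w : ℂ | 0 < w.re} := (convex_halfSpace_re_gt 0).isPreconnected
  have hA : AnalyticOnNhd ℂ (fun z : ℂ => ∫ t in Set.Ioi (0:ℝ),
      (t : ℂ) ^ (s - 1) * Complex.exp (-(z * t))) {w : ℂ | 0 < w.re} :=
    DifferentiableOn.analyticOnNhd
      (fun w hw => (aux_diff hs hw).differentiableWithinAt) hopen
  have hB : AnalyticOnNhd ℂ (fun z : ℂ => z ^ (-s) * Complex.Gamma s) {w : ℂ | 0 < w.re} := by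
    refine DifferentiableOn.analyticOnNhd (fun w hw => ?_) hopen
    apply DifferentiableAt.differentiableWithinAt
    exact (differentiableAt_id.cpow_const (Or.inl hw)).mul_const _
  refine hA.eqOn_of_preconnected_of_frequently_eq hB hconv (z₀ := 1) (by simp) ?_ hz
  have ht : Tendsto (fun n : ℕ => ((1 + 1 / ((n:ℝ) + 1) : ℝ) : ℂ)) atTop
      (nhdsWithin 1 {1}ᶜ) := by
    refine tendsto_nhdsWithin_iff.mpr ⟨?_, Eventually.of_forall fun n => ?_⟩
    · have := (tendsto_one_div_add_atTop_nhds_zero_nat (𝕜 := ℝ)).const_add 1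
      rw [add_zero] at this
      have h2 := (continuous_ofReal.tendsto 1).comp this
      rw [ofReal_one] at h2
      exact h2
    · have : (0:ℝ) < 1 / ((n:ℝ)+1) := by positivity
      simp only [Set.mem_compl_iff, Set.mem_singleton_iff]
      intro h
      rw [ofReal_eq_one] at h
      linarith
  refine ht.frequently (Eventually.frequently (Eventually.of_forall fun n => ?_))
  have hp : (0:ℝ) < 1 + 1 / ((n:ℝ)+1) := by positivity
  rw [Complex.integral_cpow_mul_exp_neg_mul_Ioi hs hp, one_div, 
    inv_cpow _ _ (by rw [arg_ofReal_of_nonneg hp.le]; exact pi_pos.ne), cpow_neg]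

lemma aux_tail {s z : ℂ} (hs : 0 < s.re) (hs2 : s.re < 1) (hz : 0 < z.re) {R : ℝ} (hR : 0 < R) :
    ‖∫ t in Set.Ioi R, (t : ℂ) ^ (s - 1) * Complex.exp (-(z * t))‖ ≤
      (1 + ‖s - 1‖ / (1 - s.re)) * R ^ (s.re - 1) / ‖z‖ := by
  have hz0 : z ≠ 0 := by rintro rfl; simp at hz
  have hs0 : s - 1 ≠ 0 := by
    intro h; have := congrArg Complex.re h; simp at this; linarith
  have hsub : Set.Ioi R ⊆ Set.Ioi 0 := Set.Ioi_subset_Ioi hR.le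
  have hi1 := (aux_int hs hz).mono_set hsub
  have hbd : ∀ t ∈ Set.Ioi R, ‖(t : ℂ) ^ (s - 1 - 1) * Complex.exp (-(z * t))‖ ≤
      t ^ (s.re - 2) := by
    intro t ht
    have ht0 : 0 < t := hsub ht
    rw [aux_norm _ _ ht0]
    have : rexp (-z.re * t) ≤ 1 := Real.exp_le_one_iff.mpr (by nlinarith)
    have e : (s - 1).re - 1 = s.re - 2 := by simp; ring
    rw [e]
    exact mul_le_of_le_one_right (by positivity) this
  have hri : IntegrableOn (fun t : ℝ => t ^ (s.re - 2)) (Set.Ioi R) :=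
    integrableOn_Ioi_rpow_of_lt (by linarith) hR
  have hi2 : IntegrableOn (fun t : ℝ => (t : ℂ) ^ (s - 1 - 1) * Complex.exp (-(z * t)))
      (Set.Ioi R) := by
    refine Integrable.mono' hri (aux_meas _ z _ hsub measurableSet_Ioi) ?_
    filter_upwards [ae_restrict_mem measurableSet_Ioi] with t ht
    exact hbd t ht
  have hder : ∀ t ∈ Set.Ici R, HasDerivAt (fun t : ℝ => (t : ℂ) ^ (s - 1) * Complex.exp (-(z * t)))
      ((s - 1) * ((t : ℂ) ^ (s - 1 - 1) * Complex.exp (-(z * t))) -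
        z * ((t : ℂ) ^ (s - 1) * Complex.exp (-(z * t)))) t := by
    intro t ht
    have ht0 : 0 < t := lt_of_lt_of_le hR ht
    have h1 : HasDerivAt (fun t : ℝ => Complex.exp (-(z * t)))
        (Complex.exp (-(z * t)) * (-(z * 1))) t :=
      (((hasDerivAt_id t).ofReal_comp.const_mul z).neg).cexp
    refine ((hasDerivAt_ofReal_cpow_const ht0.ne' hs0).mul h1).congr_deriv ?_
    ring
  have hlim : Tendsto (fun t : ℝ => (t : ℂ) ^ (s - 1) * Complex.exp (-(z * t))) atTop (nhds 0) := by
    rw [tendsto_zero_iff_norm_tendsto_zero]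
    refine (tendsto_rpow_mul_exp_neg_mul_atTop_nhds_zero (s.re - 1) z.re hz).congr' ?_
    filter_upwards [eventually_gt_atTop 0] with t ht
    exact (aux_norm s z ht).symm
  have key := integral_Ioi_of_hasDerivAt_of_tendsto' hder
    ((hi2.const_mul _).sub (hi1.const_mul _)) hlim
  rw [integral_sub (hi2.const_mul _) (hi1.const_mul _), MeasureTheory.integral_const_mul,
    MeasureTheory.integral_const_mul] at key
  set A := ∫ t in Set.Ioi R, (t : ℂ) ^ (s - 1) * Complex.exp (-(z * t))
  set B := ∫ t in Set.Ioi R, (t : ℂ) ^ (s - 1 - 1) * Complex.exp (-(z * t)) with hBdef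
  have hA : z * A = (R : ℂ) ^ (s - 1) * Complex.exp (-(z * R)) + (s - 1) * B := by
    linear_combination -key
  have hB : ‖B‖ ≤ R ^ (s.re - 1) / (1 - s.re) := by
    have := norm_integral_le_of_norm_le hri (by
      filter_upwards [ae_restrict_mem measurableSet_Ioi] with t ht
      exact hbd t ht)
    rw [integral_Ioi_rpow_of_lt (by linarith) hR] at this
    refine this.trans (le_of_eq ?_)
    have : s.re - 2 + 1 = -(1 - s.re) := by ring
    rw [this, neg_div_neg_eq]; ring_nf
  have hG : ‖(R : ℂ) ^ (s - 1) * Complex.exp (-(z * R))‖ ≤ R ^ (s.re - 1) := by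
    rw [aux_norm s z hR]
    exact mul_le_of_le_one_right (by positivity) (Real.exp_le_one_iff.mpr (by nlinarith))
  rw [le_div_iff₀ (norm_pos_iff.mpr hz0), mul_comm, ← norm_mul, hA]
  calc _ ≤ R ^ (s.re - 1) + ‖s - 1‖ * (R ^ (s.re - 1) / (1 - s.re)) := by
        refine (norm_add_le _ _).trans (add_le_add hG ?_)
        rw [norm_mul]; gcongr
    _ = _ := by ring

lemma aux_osc {s : ℂ} (hs : 0 < s.re) (hs2 : s.re < 1) {a : ℝ} (ha : 0 < a) {R : ℝ} (hR : 0 < R) :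
    ‖((a : ℂ) * I) ^ (-s) * Complex.Gamma s -
      ∫ t in (0:ℝ)..R, (t : ℂ) ^ (s - 1) * Complex.exp (-((a * I) * t))‖ ≤
      (1 + ‖s - 1‖ / (1 - s.re)) * R ^ (s.re - 1) / a := by
  set f : ℝ → ℂ := fun σ => (σ : ℂ) + a * I
  have hfc : Tendsto f (nhdsWithin 0 (Set.Ioi 0)) (nhds ((a:ℂ) * I)) := by
    have : Continuous f := by fun_prop
    have := this.tendsto 0
    simp only [f, ofReal_zero, zero_add] at this
    exact this.mono_left nhdsWithin_le_nhds
  have hev : ∀ᶠ σ in nhdsWithin (0:ℝ) (Set.Ioi 0), ‖(f σ) ^ (-s) * Complex.Gamma s -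
      ∫ t in (0:ℝ)..R, (t : ℂ) ^ (s - 1) * Complex.exp (-((f σ) * t))‖ ≤
      (1 + ‖s - 1‖ / (1 - s.re)) * R ^ (s.re - 1) / ‖f σ‖ := by
    filter_upwards [self_mem_nhdsWithin] with σ hσ
    have hre : 0 < (f σ).re := by simpa [f] using hσ
    rw [← aux_gamma hs hre, ← integral_interval_add_Ioi (aux_int hs hre)
      ((aux_int hs hre).mono_set (Set.Ioi_subset_Ioi hR.le)), add_sub_cancel_left]
    exact aux_tail hs hs2 hre hR
  have hne : (a : ℂ) * I ≠ 0 := by simp [ha.ne']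
  have hnorm : ‖(a : ℂ) * I‖ = a := by simp [abs_of_pos ha]
  have hint : ContinuousWithinAt (fun z : ℂ => ∫ t in (0:ℝ)..R, (t : ℂ) ^ (s - 1) * Complex.exp (-(z * t)))
      {w : ℂ | 0 ≤ w.re} ((a:ℂ) * I) := by
    refine intervalIntegral.continuousWithinAt_of_dominated_interval
      (bound := fun t : ℝ => t ^ (s.re - 1)) ?_ ?_ ?_ ?_
    · refine Eventually.of_forall fun z => ?_
      rw [Set.uIoc_of_le hR.le]
      exact aux_meas s z _ (fun t ht => ht.1) measurableSet_Ioc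
    · filter_upwards [self_mem_nhdsWithin] with z hz
      refine Eventually.of_forall fun t ht => ?_
      rw [Set.uIoc_of_le hR.le] at ht
      rw [aux_norm s z ht.1]
      have hz : 0 ≤ z.re := hz
      have ht0 := ht.1
      exact mul_le_of_le_one_right (by positivity) (Real.exp_le_one_iff.mpr (by nlinarith))
    · exact intervalIntegral.intervalIntegrable_rpow' (by linarith)
    · refine Eventually.of_forall fun t ht => ?_
      apply Continuous.continuousWithinAt
      fun_prop
  have hint' := (hint.tendsto.comp (tendsto_nhdsWithin_iff.mpr ⟨hfc, by
    filter_upwards [self_mem_nhdsWithin] with σ hσ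
    have : (0:ℝ) < σ := hσ
    simp [f, this.le]⟩))
  have hcp : Tendsto (fun σ => (f σ) ^ (-s)) (nhdsWithin 0 (Set.Ioi 0)) (nhds (((a:ℂ) * I) ^ (-s))) := by
    refine Tendsto.comp (continuousAt_cpow_const (Or.inr ?_)).tendsto hfc
    simp [ha.ne']
  have h1 := ((hcp.mul_const (Complex.Gamma s)).sub hint').norm
  have h2 := (tendsto_const_nhds (x := (1 + ‖s - 1‖ / (1 - s.re)) * R ^ (s.re - 1))).div hfc.norm
    (by rw [hnorm]; exact ha.ne')
  rw [hnorm] at h2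
  exact le_of_tendsto_of_tendsto h1 h2 hev

lemma aux_altgeo {q : ℂ} (hq : ‖q‖ < 1) :
    HasSum (fun n : ℕ => (-1 : ℂ) ^ (n + 1) * q ^ (n + 1)) (-(q / (1 + q))) := by
  have h := (hasSum_geometric_of_norm_lt_one (ξ := -q) (by simpa using hq)).mul_left (-q)
  have e : -q * (1 - -q)⁻¹ = -(q / (1 + q)) := by rw [sub_neg_eq_add]; ring
  rw [e] at h
  refine h.congr_fun (fun n => ?_)
  rw [← mul_pow, pow_succ]; ring

/-- The Fermi-Dirac type kernel. -/
noncomputable def fermi (δ t : ℝ) : ℂ := ((-(1 / (rexp (t + δ) + 1)) : ℝ) : ℂ)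

lemma fermi_eq (δ t : ℝ) :
    fermi δ t = -((rexp (-(t + δ)) : ℂ) / (1 + (rexp (-(t + δ)) : ℂ))) := by
  unfold fermi
  norm_cast
  rw [Real.exp_neg]
  have := Real.exp_pos (t + δ)
  congr 1
  field_simp

lemma fermi_norm {δ t : ℝ} (hδ : 0 ≤ δ) : ‖fermi δ t‖ ≤ rexp (-1 * t) := by
  unfold fermi
  rw [norm_real, norm_neg, Real.norm_of_nonneg (by positivity), neg_one_mul, Real.exp_neg, ← one_div]
  apply one_div_le_one_div_of_le (Real.exp_pos _)
  have : rexp t ≤ rexp (t + δ) := Real.exp_le_exp.mpr (by linarith)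
  linarith

lemma fermi_cont : Continuous (fun p : ℝ × ℝ => fermi p.1 p.2) := by
  unfold fermi
  refine continuous_ofReal.comp (Continuous.neg (Continuous.div (by fun_prop) (by fun_prop) ?_))
  intro p; positivity

lemma fermi_series {δ : ℝ} (hδ : 0 ≤ δ) {s : ℂ} (hs : 0 < s.re)
    (hsum : Summable fun n : ℕ => rexp (-δ * (n + 1)) / ((n : ℝ) + 1) ^ s.re) :
    HasSum (fun n : ℕ => Complex.Gamma s * ((-1) ^ (n + 1) * (rexp (-δ * (n + 1)) : ℂ)) /
      (((n : ℝ) + 1 : ℝ) : ℂ) ^ s) (mellin (fermi δ) s) := by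
  refine hasSum_mellin (p := fun n : ℕ => (n : ℝ) + 1) (fun n => Or.inr (by positivity)) hs ?_ ?_
  · intro t ht
    have ht : 0 < t := ht
    rw [fermi_eq]
    refine (aux_altgeo (q := (rexp (-(t + δ)) : ℂ)) ?_).congr_fun (fun n => ?_)
    · rw [norm_real, Real.norm_of_nonneg (Real.exp_pos _).le]
      exact Real.exp_lt_one_iff.mpr (by linarith)
    · rw [mul_assoc]
      congr 1
      norm_cast
      rw [← Real.exp_add, ← Real.exp_nat_mul]
      congr 1
      push_cast
      ring
  · refine hsum.congr (fun n => ?_)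
    rw [norm_mul, norm_real, Real.norm_of_nonneg (Real.exp_pos _).le]
    simp

lemma half_ne : ((1/2 : ℝ) : UnitAddCircle) ≠ 0 := by
  intro h
  rw [AddCircle.coe_eq_zero_iff] at h
  obtain ⟨n, hn⟩ := h
  simp only [zsmul_eq_mul, mul_one] at hn
  have h2 : ((2 * n : ℤ) : ℝ) = (1 : ℤ) := by push_cast; linarith
  have := Int.cast_injective h2
  omega

lemma cos_aux (n : ℕ) : Real.cos (2 * π * (1/2) * n) = (-1) ^ n := by
  rw [show 2 * π * (1/2) * (n:ℝ) = n * π by ring, Real.cos_nat_mul_pi]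

lemma eta_zeta {s : ℂ} (hs : s ≠ 1) :
    HurwitzZeta.cosZeta ((1/2 : ℝ) : UnitAddCircle) s = ((2 : ℂ) ^ (1 - s) - 1) * riemannZeta s := by
  have hpc : IsPreconnected ({1}ᶜ : Set ℂ) :=
    (isConnected_compl_singleton_of_one_lt_rank (by simp) 1).isPreconnected
  have hA : AnalyticOnNhd ℂ (HurwitzZeta.cosZeta ((1/2 : ℝ) : UnitAddCircle)) ({1}ᶜ : Set ℂ) :=
    (HurwitzZeta.differentiable_cosZeta_of_ne_zero half_ne).differentiableOn.analyticOnNhd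
      isOpen_compl_singleton
  have hB : AnalyticOnNhd ℂ (fun s => ((2 : ℂ) ^ (1 - s) - 1) * riemannZeta s) ({1}ᶜ : Set ℂ) := by
    refine DifferentiableOn.analyticOnNhd (fun w hw => ?_) isOpen_compl_singleton
    apply DifferentiableAt.differentiableWithinAt
    refine DifferentiableAt.mul ?_ (differentiableAt_riemannZeta hw)
    refine DifferentiableAt.sub_const ?_ _
    exact DifferentiableAt.const_cpow (by fun_prop) (Or.inl two_ne_zero)
  refine hA.eqOn_of_preconnected_of_eventuallyEq hB hpc (z₀ := 2) (by simp) ?_ hs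
  have : {w : ℂ | 1 < w.re} ∈ nhds (2:ℂ) :=
    (isOpen_lt continuous_const continuous_re).mem_nhds (by simp)
  filter_upwards [this] with w hw
  have hw : 1 < w.re := hw
  have h1 := HurwitzZeta.hasSum_nat_cosZeta (1/2) hw
  have h2 : HasSum (fun n : ℕ => 1 / (n : ℂ) ^ w) (riemannZeta w) := by
    rw [zeta_eq_tsum_one_div_nat_cpow hw]
    exact (Complex.summable_one_div_nat_cpow.mpr hw).hasSum
  have h3 := h1.add h2
  have h4 : HasSum (fun n : ℕ => ((Real.cos (2 * π * (1/2) * n) : ℝ) : ℂ) / (n : ℂ) ^ w +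
      1 / (n : ℂ) ^ w) ((2 / (2:ℂ) ^ w) * riemannZeta w + 0) := by
    refine HasSum.even_add_odd ((h2.mul_left (2 / (2:ℂ)^w)).congr_fun fun k => ?_) 
      (hasSum_zero.congr_fun fun k => ?_)
    · rw [cos_aux, pow_mul]
      have := natCast_mul_natCast_cpow 2 k w
      push_cast at this ⊢
      rw [this]
      simp only [neg_one_sq, one_pow]
      field_simp
      norm_num
    · rw [cos_aux, pow_succ, pow_mul]
      push_cast
      simp only [neg_one_sq, one_pow]
      ring
  have h5 := h3.unique h4
  rw [cpow_sub _ _ two_ne_zero, cpow_one]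
  linear_combination h5

lemma fermi_conv {s : ℂ} (hs : 0 < s.re) : DifferentiableAt ℂ (mellin (fermi 0)) s := by
  have hc : Continuous (fermi 0) := fermi_cont.comp (by fun_prop : Continuous fun t : ℝ => ((0:ℝ), t))
  refine mellin_differentiableAt_of_isBigO_rpow_exp (a := 1) (b := 0) one_pos
    (hc.locallyIntegrable.locallyIntegrableOn _) ?_ ?_ hs
  · refine Asymptotics.IsBigO.of_bound 1 (Eventually.of_forall fun t => ?_)
    rw [one_mul, Real.norm_of_nonneg (Real.exp_pos _).le]
    exact fermi_norm le_rfl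
  · refine Asymptotics.IsBigO.of_bound 1 ?_
    filter_upwards [self_mem_nhdsWithin] with t ht
    have ht : 0 < t := ht
    refine (fermi_norm le_rfl).trans ?_
    simpa using ht.le

lemma fermi_zero {s : ℂ} (hs : 0 < s.re) :
    mellin (fermi 0) s =
      Complex.Gamma s * HurwitzZeta.cosZeta ((1/2 : ℝ) : UnitAddCircle) s := by
  have hopen : IsOpen {w : ℂ | 0 < w.re} := isOpen_lt continuous_const continuous_re
  have hconv : IsPreconnected {w : ℂ | 0 < w.re} := (convex_halfSpace_re_gt 0).isPreconnected
  have hA : AnalyticOnNhd ℂ (mellin (fermi 0)) {w : ℂ | 0 < w.re} :=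
    DifferentiableOn.analyticOnNhd (fun w hw => (fermi_conv hw).differentiableWithinAt) hopen
  have hB : AnalyticOnNhd ℂ (fun s => Complex.Gamma s *
      HurwitzZeta.cosZeta ((1/2 : ℝ) : UnitAddCircle) s) {w : ℂ | 0 < w.re} := by
    refine DifferentiableOn.analyticOnNhd (fun w hw => ?_) hopen
    apply DifferentiableAt.differentiableWithinAt
    refine DifferentiableAt.mul (Complex.differentiableAt_Gamma w fun m h => ?_)
      (HurwitzZeta.differentiable_cosZeta_of_ne_zero half_ne w)
    have hw : 0 < w.re := hw
    rw [h] at hw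
    simp at hw
    have : (0:ℝ) ≤ m := m.cast_nonneg
    linarith
  refine hA.eqOn_of_preconnected_of_eventuallyEq hB hconv (z₀ := 2) (by simp) ?_ hs
  have : {w : ℂ | 1 < w.re} ∈ nhds (2:ℂ) :=
    (isOpen_lt continuous_const continuous_re).mem_nhds (by simp)
  filter_upwards [this] with w hw
  have hw : 1 < w.re := hw
  have hw0 : w ≠ 0 := by rintro rfl; simp at hw; linarith
  have h1 := (hasSum_nat_add_iff' 1).mpr (HurwitzZeta.hasSum_nat_cosZeta (1/2) hw)
  have h2 := h1.mul_left (Complex.Gamma w)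
  have h3 := fermi_series (δ := 0) le_rfl (s := w) (by linarith) (by
    have := (summable_nat_add_iff 1).mpr (Real.summable_one_div_nat_rpow.mpr hw)
    simpa using this)
  simp only [Finset.range_one, Finset.sum_singleton, Nat.cast_zero, zero_cpow hw0, div_zero,
    sub_zero] at h2
  refine h3.unique (h2.congr_fun fun n => ?_)
  rw [cos_aux]
  push_cast
  simp
  ring

lemma fermi_tendsto {s : ℂ} (hs : 0 < s.re) :
    Tendsto (fun δ => mellin (fermi δ) s) (nhdsWithin 0 (Set.Ioi 0)) (nhds (mellin (fermi 0) s)) := by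
  unfold mellin
  refine tendsto_integral_filter_of_dominated_convergence
    (fun t : ℝ => t ^ (s.re - 1) * rexp (-1 * t)) ?_ ?_ (aux_real_int hs one_pos) ?_
  · refine Eventually.of_forall fun δ => ?_
    have hc : Continuous (fermi δ) := fermi_cont.comp (by fun_prop : Continuous fun t : ℝ => ((δ:ℝ), t))
    apply ContinuousOn.aestronglyMeasurable _ measurableSet_Ioi
    intro t ht
    have : (0:ℝ) < t := ht
    apply ContinuousAt.continuousWithinAt
    exact (continuousAt_ofReal_cpow_const _ _ (Or.inr this.ne')).smul hc.continuousAt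
  · filter_upwards [self_mem_nhdsWithin] with δ hδ
    filter_upwards [ae_restrict_mem measurableSet_Ioi] with t ht
    have ht : 0 < t := ht
    have hδ : 0 < δ := hδ
    rw [norm_smul, norm_cpow_eq_rpow_re_of_pos ht]
    have := fermi_norm (t := t) hδ.le
    simp only [sub_re, one_re]
    gcongr
  · refine Eventually.of_forall fun t => ?_
    have hc : Continuous (fun δ => fermi δ t) :=
      fermi_cont.comp (by fun_prop : Continuous fun δ : ℝ => ((δ:ℝ), t))
    exact (((hc.tendsto 0).mono_left nhdsWithin_le_nhds)).const_smul _

lemma aux_cpow (s : ℂ) (n : ℕ) :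
    ((2 * π * (n + 1) : ℝ) * I : ℂ) ^ (-s) = (2 * (π : ℂ) * I) ^ (-s) / (((n : ℝ) + 1 : ℝ) : ℂ) ^ s := by
  have hn : (0:ℝ) < n + 1 := by positivity
  have hp : (2 * (π : ℂ) * I) ≠ 0 := by simp [pi_ne_zero]
  have e : ((2 * π * (n + 1) : ℝ) * I : ℂ) = (((n : ℝ) + 1 : ℝ) : ℂ) * (2 * (π : ℂ) * I) := by
    push_cast; ring
  have hn' : (((n : ℝ) + 1 : ℝ) : ℂ) ≠ 0 := by exact_mod_cast hn.ne'
  rw [e, div_eq_mul_inv, ← cpow_neg, cpow_def_of_ne_zero (mul_ne_zero hn' hp),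
    cpow_def_of_ne_zero hp, cpow_def_of_ne_zero hn', log_ofReal_mul hn hp, ← Complex.exp_add,
    ofReal_log hn.le]
  ring_nf

lemma aux_integrand (ε r : ℝ) :
    (Complex.exp (-2 * (π : ℂ) * I * (1/2 + I * (ε : ℂ) - r)) - 1)⁻¹ =
      -(Complex.exp (-(2 * π * ε) - 2 * π * I * r) / (1 + Complex.exp (-(2 * π * ε) - 2 * π * I * r))) := by
  set q := Complex.exp (-(2 * π * ε) - 2 * π * I * r) with hq
  have hq0 : q ≠ 0 := Complex.exp_ne_zero _
  have e : Complex.exp (-2 * (π : ℂ) * I * (1/2 + I * (ε : ℂ) - r)) = -q⁻¹ := by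
    have h1 : -2 * (π : ℂ) * I * (1/2 + I * (ε : ℂ) - r) =
        -(π * I) + -(-(2 * π * ε) - 2 * π * I * r) := by
      linear_combination (-2 * (π : ℂ) * ε) * I_mul_I
    rw [hq, ← Complex.exp_neg, h1, Complex.exp_add, Complex.exp_neg (π * I), Complex.exp_pi_mul_I]
    norm_num
  rw [e]
  have : -q⁻¹ - 1 = -((1 + q) / q) := by field_simp; ring
  rw [this, inv_neg, inv_div]

lemma aux_hasSum {s : ℂ} (hs : 0 < s.re) {ε R : ℝ} (hε : 0 < ε) (hR : 0 < R) :
    HasSum (fun n : ℕ => ((-1) ^ (n + 1) * (rexp (-(2 * π * ε) * (n + 1)) : ℂ)) *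
        ∫ r in (0:ℝ)..R, (r : ℂ) ^ (s - 1) * Complex.exp (-(((2 * π * (n + 1) : ℝ) * I) * r)))
      (∫ r in (0:ℝ)..R, (r : ℂ) ^ (s - 1) *
              (Complex.exp (-2 * (π : ℂ) * I * (1/2 + I * (ε : ℂ) - r)) - 1)⁻¹) := by
  simp_rw [← intervalIntegral.integral_const_mul]
  have hρ : rexp (-(2 * π * ε)) < 1 := Real.exp_lt_one_iff.mpr (by have := pi_pos; nlinarith [mul_pos this hε])
  have hsm : Summable fun n : ℕ => rexp (-(2 * π * ε)) ^ (n + 1) :=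
    (summable_nat_add_iff 1).mpr (summable_geometric_of_lt_one (Real.exp_pos _).le hρ)
  refine intervalIntegral.hasSum_integral_of_dominated_convergence
    (fun n r => rexp (-(2 * π * ε)) ^ (n + 1) * r ^ (s.re - 1)) ?_ ?_ ?_ ?_ ?_
  · intro n
    rw [Set.uIoc_of_le hR.le]
    exact (aux_meas s _ _ (fun t ht => ht.1) measurableSet_Ioc).const_mul _
  · intro n
    refine Eventually.of_forall fun r hr => ?_
    rw [Set.uIoc_of_le hR.le] at hr
    rw [norm_mul, aux_norm _ _ hr.1, norm_mul, norm_real, Real.norm_of_nonneg (Real.exp_pos _).le,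
      ← Real.exp_nat_mul]
    apply le_of_eq
    simp
    left
    ring
  · exact Eventually.of_forall fun r _ => hsm.mul_right _
  · simp_rw [tsum_mul_right]
    exact (intervalIntegral.intervalIntegrable_rpow' (by linarith)).const_mul _
  · refine Eventually.of_forall fun r hr => ?_
    rw [aux_integrand]
    refine ((aux_altgeo (q := Complex.exp (-(2 * π * ε) - 2 * π * I * r)) ?_).mul_left
      ((r:ℂ) ^ (s - 1))).congr_fun fun n => ?_
    · rw [Complex.norm_exp]
      simpa using hρ
    · rw [← Complex.exp_nat_mul, ofReal_exp]
      have : Complex.exp (((n + 1 : ℕ) : ℂ) * (-(2 * π * ε) - 2 * π * I * r)) =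
          Complex.exp ((-(2 * π * ε) * (n + 1) : ℝ) : ℂ) *
          Complex.exp (-(((2 * π * (n + 1) : ℝ) * I) * r)) := by
        rw [← Complex.exp_add]; congr 1; push_cast; ring
      rw [this]; ring

/-- The Riemann zeta function as a Riemann–Liouville differintegral: for `0 < Re s < 1`,
`ζ(s) = (2πi)^s/(2^{1−s} − 1)` times the fractional integral of order `−s`
(constant of differintegration `−∞`) of `u ↦ 1/(e^{−2πiu} − 1)` at `u = 1/2`, the
differintegral at the real point `1/2` understood as the iterated limit
`ε → 0⁺` of the improper limit `R → ∞` evaluated at `1/2 + iε`. -/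
theorem lerch_stmt9 (s : ℂ) (hs1 : 0 < s.re) (hs2 : s.re < 1) :
    ∃ g : ℝ → ℂ, ∃ L : ℂ,
      (∀ ε : ℝ, 0 < ε → Tendsto (fun R : ℝ =>
          (1 / Complex.Gamma s) * ∫ r in (0:ℝ)..R,
            (r : ℂ) ^ (s - 1) *
              (Complex.exp (-2 * (π : ℂ) * I * (1/2 + I * (ε : ℂ) - r)) - 1)⁻¹)
        atTop (nhds (g ε))) ∧
      Tendsto g (nhdsWithin 0 (Set.Ioi 0)) (nhds L) ∧
      riemannZeta s = (2 * (π : ℂ) * I) ^ s / ((2 : ℂ) ^ (1 - s) - 1) * L := by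
  have hΓ : Complex.Gamma s ≠ 0 := Complex.Gamma_ne_zero_of_re_pos hs1
  have hsne : s ≠ 1 := by rintro rfl; simp at hs2
  refine ⟨fun ε => (1 / Complex.Gamma s) * ((2 * (π : ℂ) * I) ^ (-s) * mellin (fermi (2 * π * ε)) s),
    (1 / Complex.Gamma s) * ((2 * (π : ℂ) * I) ^ (-s) * mellin (fermi 0) s), ?_, ?_, ?_⟩
  · intro ε hε
    refine Tendsto.const_mul _ ?_
    have hδ : 0 < 2 * π * ε := by positivity
    have hρ : rexp (-(2 * π * ε)) < 1 := Real.exp_lt_one_iff.mpr (by linarith)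
    have hsm : Summable fun n : ℕ => rexp (-(2 * π * ε) * (n + 1)) := by
      refine ((summable_nat_add_iff 1).mpr
        (summable_geometric_of_lt_one (Real.exp_pos _).le hρ)).congr fun n => ?_
      rw [← Real.exp_nat_mul]; push_cast; ring_nf
    have hpw : ∀ n : ℕ, 1 ≤ ((n : ℝ) + 1) ^ s.re := fun n =>
      Real.one_le_rpow (by have : (0:ℝ) ≤ n := n.cast_nonneg; linarith) hs1.le
    have hser := (fermi_series hδ.le hs1 (hsm.of_nonneg_of_le (fun n => by positivity)
      (fun n => div_le_self (Real.exp_pos _).le (hpw n)))).mul_left ((2 * (π : ℂ) * I) ^ (-s))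
    have hser' : ∑' n : ℕ, ((-1) ^ (n + 1) * (rexp (-(2 * π * ε) * (n + 1)) : ℂ)) *
        (((2 * π * (n + 1) : ℝ) * I : ℂ) ^ (-s) * Complex.Gamma s) =
        (2 * (π : ℂ) * I) ^ (-s) * mellin (fermi (2 * π * ε)) s := by
      rw [← hser.tsum_eq]
      refine tsum_congr fun n => ?_
      rw [aux_cpow]; ring
    rw [← hser']
    set C := 1 + ‖s - 1‖ / (1 - s.re) with hC
    have hC0 : 0 ≤ C := by
      have : 0 < 1 - s.re := by linarith
      positivity
    set K := ‖(2 * (π : ℂ) * I) ^ (-s)‖ * ‖Complex.Gamma s‖ with hK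
    have hmain : Tendsto (fun R : ℝ => ∑' n : ℕ,
        ((-1) ^ (n + 1) * (rexp (-(2 * π * ε) * (n + 1)) : ℂ)) *
        ∫ r in (0:ℝ)..R, (r : ℂ) ^ (s - 1) * Complex.exp (-(((2 * π * (n + 1) : ℝ) * I) * r)))
        atTop (nhds (∑' n : ℕ, ((-1) ^ (n + 1) * (rexp (-(2 * π * ε) * (n + 1)) : ℂ)) *
        (((2 * π * (n + 1) : ℝ) * I : ℂ) ^ (-s) * Complex.Gamma s))) := by
      refine tendsto_tsum_of_dominated_convergence
        (bound := fun n : ℕ => rexp (-(2 * π * ε) * (n + 1)) * (K + C)) (hsm.mul_right _) ?_ ?_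
      · intro n
        refine Tendsto.const_mul _ ?_
        rw [tendsto_iff_norm_sub_tendsto_zero]
        have hR : Tendsto (fun R : ℝ => C * R ^ (s.re - 1) / (2 * π * (n + 1))) atTop (nhds 0) := by
          have := (tendsto_rpow_neg_atTop (y := 1 - s.re) (by linarith))
          rw [neg_sub] at this
          simpa using (this.const_mul C).div_const (2 * π * (n + 1))
        refine squeeze_zero' (Eventually.of_forall fun _ => norm_nonneg _) ?_ hR
        filter_upwards [eventually_gt_atTop 0] with R hR0
        rw [norm_sub_rev]
        exact aux_osc hs1 hs2 (by positivity) hR0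
      · filter_upwards [eventually_ge_atTop 1] with R hR1 n
        have hR0 : 0 < R := by linarith
        rw [norm_mul, norm_mul, norm_real, Real.norm_of_nonneg (Real.exp_pos _).le, norm_pow,
          norm_neg, norm_one, one_pow, one_mul]
        refine mul_le_mul_of_nonneg_left ?_ (Real.exp_pos _).le
        have ha : (1:ℝ) ≤ 2 * π * (n + 1) := by
          have h3 := pi_gt_three
          have : (0:ℝ) ≤ n := n.cast_nonneg
          nlinarith
        have h1 := aux_osc hs1 hs2 (a := 2 * π * (n + 1)) (by positivity) hR0
        have h2 : C * R ^ (s.re - 1) / (2 * π * (n + 1)) ≤ C := by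
          refine (div_le_self (by positivity) ha).trans ?_
          exact mul_le_of_le_one_right hC0 (Real.rpow_le_one_of_one_le_of_nonpos hR1 (by linarith))
        have h3 : ‖((2 * π * (n + 1) : ℝ) * I : ℂ) ^ (-s) * Complex.Gamma s‖ ≤ K := by
          rw [aux_cpow, norm_mul, norm_div, norm_cpow_eq_rpow_re_of_pos (by positivity)]
          refine mul_le_mul_of_nonneg_right ?_ (norm_nonneg _)
          exact div_le_self (norm_nonneg _) (hpw n)
        rw [norm_sub_rev] at h1
        have h4 := norm_le_norm_add_norm_sub' (∫ r in (0:ℝ)..R, (r : ℂ) ^ (s - 1) * Complex.exp (-(((2 * π * (n + 1) : ℝ) * I) * r))) (((2 * π * (n + 1) : ℝ) * I : ℂ) ^ (-s) * Complex.Gamma s)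
        linarith
    refine hmain.congr' ?_
    filter_upwards [eventually_gt_atTop 0] with R hR0
    exact (aux_hasSum hs1 hε hR0).tsum_eq
  · refine Tendsto.const_mul _ (Tendsto.const_mul _ ?_)
    refine (fermi_tendsto hs1).comp (tendsto_nhdsWithin_iff.mpr ⟨?_, ?_⟩)
    · have : Continuous fun ε : ℝ => 2 * π * ε := by fun_prop
      have h := this.tendsto 0
      rw [mul_zero] at h
      exact h.mono_left nhdsWithin_le_nhds
    · filter_upwards [self_mem_nhdsWithin] with ε hε
      have hε : 0 < ε := hε
      exact (by positivity : 0 < 2 * π * ε)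
  · rw [fermi_zero hs1, eta_zeta hsne, cpow_neg]
    have h1 : (2 * (π : ℂ) * I) ^ s ≠ 0 := by
      rw [Ne, cpow_eq_zero_iff]; simp [pi_ne_zero]
    have h2 : (2 : ℂ) ^ (1 - s) - 1 ≠ 0 := by
      intro h
      have h3 : ‖(2 : ℂ) ^ (1 - s)‖ = 1 := by rw [sub_eq_zero.mp h]; simp
      have h4 := norm_cpow_eq_rpow_re_of_pos (x := 2) (by norm_num) (1 - s)
      rw [ofReal_ofNat, h3] at h4
      have h5 : (1:ℝ) < 2 ^ (1 - s).re := Real.one_lt_rpow (by norm_num) (by simp; linarith)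
      linarith
    field_simp
end

section
/- Let a > 0 be real and let s ∈ ℂ with 0 < Re(s) < 1. Then the improper integrals lim_{R→∞} ∫_0^R p^{s−1} · e^{2πiap} dp and lim_{R→∞} ∫_0^R p^{s−1} · e^{−2πiap} dp both exist, and lim_{R→∞} ∫_0^R p^{s−1} · e^{2πiap} dp = e^{iπs} · lim_{R→∞} ∫_0^R p^{s−1} · e^{−2πiap} dp. -/
open Complex Real Filter intervalIntegral

namespace LerchAux
open MeasureTheory Set Topology

lemma contOn (z w : ℂ) :
    ContinuousOn (fun p : ℝ => (p : ℂ) ^ z * Complex.exp (-(w * p))) (Ioi 0) := by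
  intro x hx
  apply ContinuousAt.continuousWithinAt
  exact (Complex.continuousAt_ofReal_cpow_const x z (Or.inr (ne_of_gt hx))).mul (by fun_prop)

lemma meas (z w : ℂ) {c : ℝ} (hc : 0 ≤ c) :
    AEStronglyMeasurable (fun p : ℝ => (p : ℂ) ^ z * Complex.exp (-(w * p)))
      (volume.restrict (Ioi c)) :=
  ((contOn z w).mono (Ioi_subset_Ioi hc)).aestronglyMeasurable measurableSet_Ioi

lemma norm_eq (z w : ℂ) {p : ℝ} (hp : 0 < p) :
    ‖(p : ℂ) ^ z * Complex.exp (-(w * p))‖ = p ^ z.re * Real.exp (-w.re * p) := by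
  rw [norm_mul, Complex.norm_cpow_eq_rpow_re_of_pos hp, Complex.norm_exp]
  simp

lemma norm_le (z w : ℂ) (hw : 0 ≤ w.re) {p : ℝ} (hp : 0 < p) :
    ‖(p : ℂ) ^ z * Complex.exp (-(w * p))‖ ≤ ‖(p : ℂ) ^ z‖ := by
  rw [norm_eq z w hp, Complex.norm_cpow_eq_rpow_re_of_pos hp]
  have : Real.exp (-w.re * p) ≤ 1 := by
    rw [Real.exp_le_one_iff]; nlinarith
  exact mul_le_of_le_one_right (Real.rpow_nonneg hp.le _) this

lemma int_exp (z : ℂ) (hz : -1 < z.re) {b : ℝ} (hb : 0 < b) :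
    IntegrableOn (fun p : ℝ => p ^ z.re * Real.exp (-b * p)) (Ioi 0) := by
  simpa using integrableOn_rpow_mul_exp_neg_mul_rpow (p := 1) hz one_pos hb

lemma int_lap (z w : ℂ) (hz : -1 < z.re) (hw : 0 < w.re) :
    IntegrableOn (fun p : ℝ => (p : ℂ) ^ z * Complex.exp (-(w * p))) (Ioi 0) := by
  refine Integrable.mono' (int_exp z hz hw) (meas z w le_rfl) ?_
  filter_upwards [ae_restrict_mem measurableSet_Ioi] with p hp
  exact (norm_eq z w hp).le

lemma diff_lap (s : ℂ) (hs : 0 < s.re) (w : ℂ) (hw : 0 < w.re) :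
    DifferentiableAt ℂ
      (fun w : ℂ => ∫ p in Ioi (0:ℝ), (p : ℂ) ^ (s - 1) * Complex.exp (-(w * p))) w := by
  have hU : {x : ℂ | w.re / 2 < x.re} ∈ 𝓝 w :=
    (isOpen_lt continuous_const Complex.continuous_re).mem_nhds (by simp; linarith)
  refine (hasDerivAt_integral_of_dominated_loc_of_deriv_le (𝕜 := ℂ) hU
    (F := fun (w : ℂ) (p : ℝ) => (p : ℂ) ^ (s - 1) * Complex.exp (-(w * p)))
    (F' := fun (w : ℂ) (p : ℝ) => -((p : ℂ) ^ s * Complex.exp (-(w * p))))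
    (bound := fun p : ℝ => p ^ s.re * Real.exp (-(w.re / 2) * p))
    (Eventually.of_forall fun x => meas _ _ le_rfl) (int_lap _ _ (by simpa using hs) hw)
    (meas _ _ le_rfl).neg ?_ (int_exp s (by linarith) (by linarith)) ?_).2.differentiableAt
  · filter_upwards [ae_restrict_mem measurableSet_Ioi] with p hp x hx
    have hp : 0 < p := hp
    have hx : w.re / 2 < x.re := hx
    rw [norm_neg, norm_eq _ _ hp]
    gcongr
  · filter_upwards [ae_restrict_mem measurableSet_Ioi] with p hp x hx
    have hp : 0 < p := hp
    have hp' : (p : ℂ) ≠ 0 := by exact_mod_cast hp.ne'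
    have h1 : HasDerivAt (fun x : ℂ => -(x * (p : ℂ))) (-(1 * (p : ℂ))) x :=
      ((hasDerivAt_id x).mul_const _).neg
    convert! (h1.cexp.const_mul ((p : ℂ) ^ (s - 1))) using 1
    rw [Complex.cpow_sub _ _ hp', Complex.cpow_one]
    field_simp

lemma lap_eq (s : ℂ) (hs : 0 < s.re) (w : ℂ) (hw : 0 < w.re) :
    ∫ p in Ioi (0:ℝ), (p : ℂ) ^ (s - 1) * Complex.exp (-(w * p))
      = (1 / w) ^ s * Complex.Gamma s := by
  have hUo : IsOpen {x : ℂ | 0 < x.re} := isOpen_lt continuous_const Complex.continuous_re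
  have key : EqOn (fun w : ℂ => ∫ p in Ioi (0:ℝ), (p : ℂ) ^ (s - 1) * Complex.exp (-(w * p)))
      (fun w : ℂ => (1 / w) ^ s * Complex.Gamma s) {x : ℂ | 0 < x.re} := by
    refine AnalyticOnNhd.eqOn_of_preconnected_of_frequently_eq (z₀ := 1) ?_ ?_ ?_ ?_ ?_
    · exact DifferentiableOn.analyticOnNhd
        (fun x hx => (diff_lap s hs x hx).differentiableWithinAt) hUo
    · refine DifferentiableOn.analyticOnNhd (fun x hx => ?_) hUo
      have hx : 0 < x.re := hx
      have hx0 : x ≠ 0 := by rintro rfl; simp at hx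
      apply DifferentiableAt.differentiableWithinAt
      refine DifferentiableAt.mul_const (DifferentiableAt.cpow_const ?_ ?_) _
      · exact (differentiableAt_const _).div differentiableAt_id hx0
      · left
        simp only [one_div, Complex.inv_re]
        exact div_pos hx (Complex.normSq_pos.2 hx0)
    · exact (convex_halfSpace_re_gt 0).isPreconnected
    · simp
    · have ht : Tendsto (fun r : ℝ => (r : ℂ)) (𝓝[>] 1) (𝓝[≠] 1) := by
        refine tendsto_nhdsWithin_iff.2 ⟨?_, ?_⟩
        · exact (Complex.continuous_ofReal.tendsto' 1 1 (by simp)).mono_left nhdsWithin_le_nhds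
        · filter_upwards [self_mem_nhdsWithin] with r hr
          have hr : 1 < r := hr
          simp [hr.ne']
      refine ht.frequently (Eventually.frequently ?_)
      filter_upwards [self_mem_nhdsWithin] with r hr
      have hr : 1 < r := hr
      exact Complex.integral_cpow_mul_exp_neg_mul_Ioi hs (by linarith)
  exact key hw

/-- The regularized value of the improper integral. -/
noncomputable def F (s w : ℂ) : ℂ :=
  (∫ p in (0:ℝ)..1, (p : ℂ) ^ (s - 1) * Complex.exp (-(w * p))) +
  (Complex.exp (-w) / w +
    (s - 1) / w * ∫ p in Ioi (1:ℝ), (p : ℂ) ^ (s - 2) * Complex.exp (-(w * p)))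

lemma int01 (s w : ℂ) (hs : 0 < s.re) (a b : ℝ) :
    IntervalIntegrable (fun p : ℝ => (p : ℂ) ^ (s - 1) * Complex.exp (-(w * p))) volume a b := by
  refine (intervalIntegrable_cpow' (by simpa using hs)).mul_continuousOn ?_
  fun_prop

lemma int1 (s w : ℂ) (hs : s.re < 1) (hw : 0 ≤ w.re) :
    IntegrableOn (fun p : ℝ => (p : ℂ) ^ (s - 2) * Complex.exp (-(w * p))) (Ioi 1) := by
  refine Integrable.mono' (integrableOn_Ioi_norm_cpow_of_lt (a := s - 2) ?_ one_pos)
    (meas _ w zero_le_one) ?_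
  · simp; linarith
  filter_upwards [ae_restrict_mem measurableSet_Ioi] with p hp
  exact norm_le _ w hw (lt_trans one_pos hp)

lemma byparts (s w : ℂ) (hs2 : s.re < 1) (hw0 : w ≠ 0) {R : ℝ} (hR : 1 ≤ R) :
    ∫ p in (1:ℝ)..R, (p : ℂ) ^ (s - 1) * Complex.exp (-(w * p)) =
      Complex.exp (-w) / w - (R : ℂ) ^ (s - 1) * Complex.exp (-(w * R)) / w
      + (s - 1) / w * ∫ p in (1:ℝ)..R, (p : ℂ) ^ (s - 2) * Complex.exp (-(w * p)) := by
  have hs1 : s - 1 ≠ 0 := by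
    intro h
    have := congrArg Complex.re h
    simp at this; linarith
  have hpos : ∀ x ∈ uIcc 1 R, 0 < x := fun x hx => by
    rw [uIcc_of_le hR] at hx; linarith [hx.1]
  have h0 : (0:ℝ) ∉ uIcc 1 R := fun h => lt_irrefl _ (hpos 0 h)
  have := integral_mul_deriv_eq_deriv_mul (a := 1) (b := R)
    (u := fun p : ℝ => (p : ℂ) ^ (s - 1)) (u' := fun p : ℝ => (s - 1) * (p : ℂ) ^ (s - 1 - 1))
    (v := fun p : ℝ => -Complex.exp (-(w * p)) / w) (v' := fun p : ℝ => Complex.exp (-(w * p)))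
    (fun x hx => hasDerivAt_ofReal_cpow_const (hpos x hx).ne' hs1)
    (fun x hx => by
      have h1 : HasDerivAt (fun x : ℝ => -(w * (x : ℂ))) (-(w * 1)) x :=
        ((Complex.ofRealCLM.hasDerivAt (x := x)).const_mul w).neg
      convert! (h1.cexp.neg.div_const w) using 1
      field_simp)
    ((intervalIntegrable_cpow (Or.inr h0)).const_mul _)
    (Continuous.intervalIntegrable (by fun_prop) _ _)
  rw [this, ← intervalIntegral.integral_const_mul]
  have e : ∀ p : ℝ, (s - 1) * (p : ℂ) ^ (s - 1 - 1) * (-Complex.exp (-(w * p)) / w)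
      = -((s - 1) / w * ((p : ℂ) ^ (s - 2) * Complex.exp (-(w * p)))) := by
    intro p
    rw [show s - 1 - 1 = s - 2 by ring]; ring
  simp only [e, intervalIntegral.integral_neg]
  simp
  ring

lemma tendsto_F (s w : ℂ) (hs1 : 0 < s.re) (hs2 : s.re < 1) (hw : 0 ≤ w.re) (hw0 : w ≠ 0) :
    Tendsto (fun R : ℝ => ∫ p in (0:ℝ)..R, (p : ℂ) ^ (s - 1) * Complex.exp (-(w * p)))
      atTop (𝓝 (F s w)) := by
  have hb : Tendsto (fun R : ℝ => (R : ℂ) ^ (s - 1) * Complex.exp (-(w * R)) / w)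
      atTop (𝓝 0) := by
    rw [← zero_div w]
    refine Tendsto.div_const ?_ w
    have h : Tendsto (fun R : ℝ => R ^ (-(1 - s.re))) atTop (𝓝 0) :=
      tendsto_rpow_neg_atTop (by linarith)
    refine squeeze_zero_norm' ?_ h
    filter_upwards [eventually_gt_atTop 0] with R hR
    refine (norm_le _ w hw hR).trans (le_of_eq ?_)
    rw [Complex.norm_cpow_eq_rpow_re_of_pos hR]
    simp
  have hi := intervalIntegral_tendsto_integral_Ioi 1 (int1 s w hs2 hw) tendsto_id
  have := (((tendsto_const_nhds (x := Complex.exp (-w) / w)).sub hb).add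
    (hi.const_mul ((s - 1) / w))).const_add
    (∫ p in (0:ℝ)..1, (p : ℂ) ^ (s - 1) * Complex.exp (-(w * p)))
  rw [sub_zero] at this
  refine this.congr' ?_
  filter_upwards [eventually_ge_atTop 1] with R hR
  rw [← intervalIntegral.integral_add_adjacent_intervals (int01 s w hs1 0 1) (int01 s w hs1 1 R),
    byparts s w hs2 hw0 hR]
  rfl

lemma cont_F (s : ℂ) (hs1 : 0 < s.re) (hs2 : s.re < 1) (w : ℂ) (hw0 : w ≠ 0) :
    ContinuousWithinAt (F s) {w : ℂ | 0 ≤ w.re} w := by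
  have hm : ∀ᶠ x in 𝓝[{w : ℂ | 0 ≤ w.re}] w, 0 ≤ x.re := self_mem_nhdsWithin
  refine ContinuousWithinAt.add ?_ (ContinuousWithinAt.add ?_ (ContinuousWithinAt.mul ?_ ?_))
  · refine continuousWithinAt_of_dominated_interval
      (bound := fun p : ℝ => ‖(p : ℂ) ^ (s - 1)‖) ?_ ?_ ?_ ?_
    · refine Eventually.of_forall fun x => ?_
      exact (int01 s x hs1 0 1).def'.aestronglyMeasurable
    · filter_upwards [hm] with x hx
      refine Eventually.of_forall fun p hp => norm_le _ x hx ?_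
      rw [uIoc_of_le zero_le_one] at hp; exact hp.1
    · exact (intervalIntegrable_cpow' (by simpa using hs1)).norm
    · exact Eventually.of_forall fun p hp => by fun_prop
  · exact ContinuousWithinAt.div (Continuous.continuousWithinAt (by fun_prop)) continuousWithinAt_id hw0
  · exact ContinuousWithinAt.div (Continuous.continuousWithinAt (by fun_prop)) continuousWithinAt_id hw0
  · refine continuousWithinAt_of_dominated
      (bound := fun p : ℝ => ‖(p : ℂ) ^ (s - 2)‖) ?_ ?_ ?_ ?_
    · exact Eventually.of_forall fun x => meas _ x zero_le_one
    · filter_upwards [hm] with x hx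
      filter_upwards [ae_restrict_mem measurableSet_Ioi] with p hp
      exact norm_le _ x hx (lt_trans one_pos hp)
    · exact integrableOn_Ioi_norm_cpow_of_lt (by simp; linarith) one_pos
    · exact Eventually.of_forall fun p => by fun_prop

lemma F_eq_pos (s w : ℂ) (hs1 : 0 < s.re) (hs2 : s.re < 1) (hw : 0 < w.re) :
    F s w = (1 / w) ^ s * Complex.Gamma s := by
  have hw0 : w ≠ 0 := by rintro rfl; simp at hw
  rw [← lap_eq s hs1 w hw]
  exact tendsto_nhds_unique (tendsto_F s w hs1 hs2 hw.le hw0)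
    (intervalIntegral_tendsto_integral_Ioi 0 (int_lap _ w (by simpa using hs1) hw) tendsto_id)

lemma F_eq (s w : ℂ) (hs1 : 0 < s.re) (hs2 : s.re < 1) (hw : 0 ≤ w.re) (hw0 : w ≠ 0)
    (hslit : 1 / w ∈ slitPlane) :
    F s w = (1 / w) ^ s * Complex.Gamma s := by
  have ht : Tendsto (fun e : ℝ => w + e) (𝓝[>] 0) (𝓝 w) :=
    (Continuous.tendsto' (by fun_prop) 0 w (by simp)).mono_left nhdsWithin_le_nhds
  have hpos : ∀ᶠ e : ℝ in 𝓝[>] 0, 0 < (w + (e : ℂ)).re := by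
    filter_upwards [self_mem_nhdsWithin] with e he
    have he : 0 < e := he
    simp; linarith
  have h1 : Tendsto (fun e : ℝ => F s (w + e)) (𝓝[>] 0) (𝓝 (F s w)) :=
    (cont_F s hs1 hs2 w hw0).tendsto.comp
      (tendsto_nhdsWithin_iff.2 ⟨ht, hpos.mono fun e he => he.le⟩)
  have hc : ContinuousAt (fun x : ℂ => (1 / x) ^ s * Complex.Gamma s) w :=
    ((continuousAt_const.div continuousAt_id hw0).cpow continuousAt_const hslit).mul
      continuousAt_const
  refine tendsto_nhds_unique h1 ((hc.tendsto.comp ht).congr' ?_)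
  filter_upwards [hpos] with e he
  exact (F_eq_pos s _ hs1 hs2 he).symm

end LerchAux

/-- For real `a > 0` and `0 < Re s < 1`, the improper integrals
`∫_0^∞ p^{s−1} e^{2πiap} dp` and `∫_0^∞ p^{s−1} e^{−2πiap} dp` (as limits `R → ∞` of
`∫_0^R`) both exist, and the first equals `e^{iπs}` times the second. -/
theorem lerch_stmt12 (a : ℝ) (ha : 0 < a) (s : ℂ) (hs1 : 0 < s.re) (hs2 : s.re < 1) :
    ∃ L L' : ℂ,
      Tendsto (fun R : ℝ => ∫ p in (0:ℝ)..R,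
          (p : ℂ) ^ (s - 1) * Complex.exp (2 * (π : ℂ) * I * (a : ℂ) * p))
        atTop (nhds L) ∧
      Tendsto (fun R : ℝ => ∫ p in (0:ℝ)..R,
          (p : ℂ) ^ (s - 1) * Complex.exp (-2 * (π : ℂ) * I * (a : ℂ) * p))
        atTop (nhds L') ∧
      L = Complex.exp ((π : ℂ) * I * s) * L' := by
  set b : ℝ := 2 * π * a with hb
  have hbp : 0 < b := by positivity
  have hbc : (b : ℂ) ≠ 0 := by exact_mod_cast hbp.ne'
  have hci : 0 < b⁻¹ := by positivity
  have h1 : 1 / (-(b * I) : ℂ) = (b⁻¹ : ℝ) * I := by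
    push_cast; field_simp; simp
  have h2 : 1 / ((b * I) : ℂ) = (b⁻¹ : ℝ) * (-I) := by
    push_cast; field_simp; simp
  have n1 : (-(b * I) : ℂ) ≠ 0 := by simp [hbp.ne']
  have n2 : ((b * I) : ℂ) ≠ 0 := by simp [hbp.ne']
  refine ⟨LerchAux.F s (-(b * I)), LerchAux.F s (b * I), ?_, ?_, ?_⟩
  · refine (LerchAux.tendsto_F s (-(b * I)) hs1 hs2 (by simp) n1).congr fun R => ?_
    congr 1; ext p; congr 2
    rw [hb]; push_cast; ring
  · refine (LerchAux.tendsto_F s (b * I) hs1 hs2 (by simp) n2).congr fun R => ?_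
    congr 1; ext p; congr 2
    rw [hb]; push_cast; ring
  · rw [LerchAux.F_eq s _ hs1 hs2 (by simp) n1 (by rw [h1]; right; simp [hbp.ne']),
      LerchAux.F_eq s _ hs1 hs2 (by simp) n2 (by rw [h2]; right; simp [hbp.ne']), h1, h2,
      ← mul_assoc]
    congr 1
    have hcc : ((b⁻¹ : ℝ) : ℂ) ≠ 0 := by exact_mod_cast hci.ne'
    rw [Complex.cpow_def_of_ne_zero (mul_ne_zero hcc I_ne_zero),
      Complex.cpow_def_of_ne_zero (mul_ne_zero hcc (neg_ne_zero.2 I_ne_zero)),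
      Complex.log_ofReal_mul hci I_ne_zero, Complex.log_ofReal_mul hci (neg_ne_zero.2 I_ne_zero),
      Complex.log_I, Complex.log_neg_I, ← Complex.exp_add]
    congr 1
    ring
end
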